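/- Let W = m_1P_1+⋯+m_sP_s be a fat point scheme in the projective plane P^2 over a field of characteristic zero. Then the Hilbert polynomial of Ω^1_{R_W/K} is the constant Σ_{j=1}^s (1/2)(3m_j−2)(m_j+1). -/

import Mathlib

open MvPolynomial

/-- The homogeneous vanishing ideal of the `K`-rational point of `ℙ^2` with homogeneous
coordinates `v`. -/
noncomputable def pointIdeal {K : Type*} [Field K] (v : Fin 3 → K) :
    Ideal (MvPolynomial (Fin 3) K) :=
  Ideal.span {F | (∃ d, F.IsHomogeneous d) ∧ MvPolynomial.eval v F = 0}

/-- The relation submodule of the presentation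
`Ω¹_{R_W/K} ≅ Ω¹_{S/K}/(I_W Ω¹_{S/K} + dI_W)`, where `Ω¹_{S/K}` is identified with `S³`
via the basis `dX₀, dX₁, dX₂`. -/
noncomputable def omega1Rel {K : Type*} [Field K] (IW : Ideal (MvPolynomial (Fin 3) K)) :
    Submodule (MvPolynomial (Fin 3) K) (Fin 3 → MvPolynomial (Fin 3) K) :=
  Submodule.pi Set.univ (fun _ => (IW : Submodule (MvPolynomial (Fin 3) K) (MvPolynomial (Fin 3) K))) ⊔
    Submodule.span (MvPolynomial (Fin 3) K)
      {x | ∃ F ∈ IW, x = fun j => (pderiv j F : MvPolynomial (Fin 3) K)}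

/-- The value `HF_{Ω¹_{R_W/K}}(i)`: the generators `dXⱼ` have degree `1`, so the degree-`i`
component consists of the vectors of homogeneous polynomials of degree `i - 1`, modulo the
degree-`i` component of the relation submodule. -/
noncomputable def omega1HF {K : Type*} [Field K] (IW : Ideal (MvPolynomial (Fin 3) K))
    (i : ℕ) : ℕ :=
  Module.finrank K
    (↥(Submodule.pi Set.univ fun _ : Fin 3 => homogeneousSubmodule (Fin 3) K (i - 1)) ⧸
      Submodule.comap
        (Submodule.pi Set.univ fun _ : Fin 3 => homogeneousSubmodule (Fin 3) K (i - 1)).subtype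
        ((omega1Rel IW).restrictScalars K))

section PointIdeal

variable {K : Type*} [Field K] {v : Fin 3 → K} {c : Fin 3}

lemma aeval_mul_const_of_isHomogeneous {σ R A : Type*} [CommSemiring R]
    [CommSemiring A] [Algebra R A] {F : MvPolynomial σ R} {d : ℕ} (hF : F.IsHomogeneous d)
    (x : σ → A) (t : A) : aeval (fun j => x j * t) F = aeval x F * t ^ d := by
  rw [aeval_def, aeval_def, eval₂_eq, eval₂_eq, Finset.sum_mul]
  refine Finset.sum_congr rfl fun a ha => ?_
  rw [hF.degree_eq_sum_deg_support ha, mul_assoc]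
  simp only [mul_pow, Finset.prod_mul_distrib, Finset.prod_pow_eq_pow_sum]

lemma pointIdeal_eq_span (hc : v c ≠ 0) :
    pointIdeal v = Ideal.span (Set.range fun j => X j - C (v j / v c) * X c) := by
  set I : Ideal (MvPolynomial (Fin 3) K) :=
    Ideal.span (Set.range fun j => X j - C (v j / v c) * X c) with hI
  have hcongr (F : MvPolynomial (Fin 3) K) :
      F - aeval (fun j => C (v j / v c) * X c) F ∈ I := by
    rw [← Ideal.Quotient.eq, ← Ideal.Quotient.mkₐ_eq_mk K, ← AlgHom.comp_apply]
    refine DFunLike.congr_fun (f := Ideal.Quotient.mkₐ K I) (MvPolynomial.algHom_ext fun j => ?_) F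
    rw [AlgHom.comp_apply, aeval_X, Ideal.Quotient.mkₐ_eq_mk, Ideal.Quotient.eq]
    exact Ideal.subset_span ⟨j, rfl⟩
  refine le_antisymm (Ideal.span_le.2 ?_) (Ideal.span_le.2 ?_)
  · rintro F ⟨⟨d, hd⟩, hF⟩
    have h1 : aeval (fun j => (C (v j / v c) : MvPolynomial (Fin 3) K)) F = 0 := by
      have h2 := aeval_mul_const_of_isHomogeneous hd v (v c)⁻¹
      rw [← coe_aeval_eq_eval, RingHom.coe_coe] at hF
      rw [hF, zero_mul] at h2
      have h3 := MvPolynomial.comp_aeval (fun j => v j / v c)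
        (Algebra.ofId K (MvPolynomial (Fin 3) K))
      have h4 := DFunLike.congr_fun h3 F
      rw [AlgHom.comp_apply] at h4
      simp only [div_eq_mul_inv] at h4 ⊢
      rw [h2, map_zero] at h4
      exact h4.symm
    have h := hcongr F
    rwa [aeval_mul_const_of_isHomogeneous hd, h1, zero_mul, sub_zero] at h
  · rintro _ ⟨j, rfl⟩
    refine Ideal.subset_span ⟨⟨1, ?_⟩, ?_⟩
    · exact (isHomogeneous_X _ _).sub (isHomogeneous_C_mul_X _ _)
    · simp [hc]

/-- The linear substitution `X_j ↦ X_j + u_j X_c` for `j ≠ c`, fixing `X_c`. -/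
noncomputable def shear (u : Fin 3 → K) (c : Fin 3) :
    MvPolynomial (Fin 3) K →ₐ[K] MvPolynomial (Fin 3) K :=
  aeval fun j => if j = c then X c else X j + C (u j) * X c

lemma shear_comp_shear_neg (u : Fin 3 → K) (c : Fin 3) :
    (shear u c).comp (shear (-u) c) = AlgHom.id K _ := by
  refine MvPolynomial.algHom_ext fun j => ?_
  by_cases h : j = c
  · simp [shear, h]
  · simp [shear, h, algHom_C, algebraMap_eq]

/-- `shear` as an automorphism of the polynomial ring. -/
noncomputable def shearEquiv (u : Fin 3 → K) (c : Fin 3) :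
    MvPolynomial (Fin 3) K ≃ₐ[K] MvPolynomial (Fin 3) K :=
  AlgEquiv.ofAlgHom (shear u c) (shear (-u) c) (shear_comp_shear_neg u c)
    (by simpa using shear_comp_shear_neg (-u) c)

lemma isHomogeneous_shear (u : Fin 3 → K) (c : Fin 3) {F : MvPolynomial (Fin 3) K} {d : ℕ}
    (hF : F.IsHomogeneous d) : (shear u c F).IsHomogeneous d := by
  have := hF.aeval (n := 1) (fun j => if j = c then X c else X j + C (u j) * X c) fun j => by
    split_ifs
    · exact isHomogeneous_X _ _
    · exact (isHomogeneous_X _ _).add (isHomogeneous_C_mul_X _ _)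
  rwa [one_mul] at this

lemma map_shearEquiv_pointIdeal (hc : v c ≠ 0) :
    (pointIdeal v).map (shearEquiv (fun j => v j / v c) c) = Ideal.span (X '' {c + 1, c + 2}) := by
  rw [pointIdeal_eq_span hc, Ideal.map_span, ← Set.range_comp]
  have hval (j : Fin 3) : shearEquiv (fun j => v j / v c) c (X j - C (v j / v c) * X c) =
      if j = c then 0 else X j := by
    change shear _ c _ = _
    by_cases h : j = c
    · simp [h, shear, hc]
    · simp [h, shear, algHom_C, algebraMap_eq]
  have hne1 : c + 1 ≠ c := by simp
  have hne2 : c + 2 ≠ c := by simp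
  have hcases := (by decide : ∀ c j : Fin 3, j = c ∨ j = c + 1 ∨ j = c + 2) c
  refine le_antisymm (Ideal.span_le.2 ?_) (Ideal.span_le.2 ?_)
  · rintro _ ⟨j, rfl⟩
    rw [Function.comp_apply, hval]
    split_ifs with h
    · exact zero_mem _
    · exact Ideal.subset_span ⟨j, (hcases j).resolve_left h, rfl⟩
  · rintro _ ⟨j, hj, rfl⟩
    refine Ideal.subset_span ⟨j, ?_⟩
    rw [Function.comp_apply, hval, if_neg]
    rcases hj with rfl | rfl <;> assumption

lemma mem_span_X_pow_iff {R : Type*} [CommSemiring R] {m : ℕ} {F : MvPolynomial (Fin 3) R} :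
    F ∈ (Ideal.span (X '' {c + 1, c + 2}) : Ideal (MvPolynomial (Fin 3) R)) ^ m ↔
      ∀ a ∈ F.support, m ≤ a (c + 1) + a (c + 2) := by
  constructor
  · intro hF
    induction m generalizing F with
    | zero => simp
    | succ m ih =>
      rw [pow_succ] at hF
      induction hF using Submodule.mul_induction_on' with
      | mem_mul_mem f hf g hg =>
        intro a ha
        obtain ⟨b, hb, e, he, rfl⟩ := Finset.mem_add.1 (support_mul f g ha)
        have h1 := ih hf b hb
        obtain ⟨i, hi, hne⟩ := mem_ideal_span_X_image.1 hg e he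
        simp only [Finsupp.add_apply]
        rcases hi with rfl | rfl <;> omega
      | add f _ g _ hf hg =>
        intro a ha
        rcases Finset.mem_union.1 (support_add ha) with h | h
        · exact hf a h
        · exact hg a h
  · intro hF
    rw [F.as_sum]
    refine Ideal.sum_mem _ fun a ha => Ideal.pow_le_pow_right (hF a ha) ?_
    have hX (j : Fin 3) (hj : j = c + 1 ∨ j = c + 2) : (X j : MvPolynomial (Fin 3) R) ∈
        (Ideal.span (X '' {c + 1, c + 2}) : Ideal (MvPolynomial (Fin 3) R)) :=
      Ideal.subset_span ⟨j, hj, rfl⟩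
    have hle : Finsupp.single (c + 1) (a (c + 1)) + Finsupp.single (c + 2) (a (c + 2)) ≤ a := by
      intro i
      have h12 : c + 1 ≠ c + 2 := by simp
      simp only [Finsupp.add_apply, Finsupp.single_apply]
      split_ifs <;> grind
    obtain ⟨b, hb⟩ := exists_add_of_le hle
    have hmon : monomial a (coeff a F) =
        X (c + 1) ^ a (c + 1) * X (c + 2) ^ a (c + 2) * monomial b (coeff a F) := by
      rw [X_pow_eq_monomial, X_pow_eq_monomial, monomial_mul, monomial_mul, ← hb]
      simp
    rw [hmon, pow_add]
    exact Ideal.mul_mem_right _ _ (Ideal.mul_mem_mul (Ideal.pow_mem_pow (hX _ (.inl rfl)) _)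
      (Ideal.pow_mem_pow (hX _ (.inr rfl)) _))

lemma mem_pointIdeal_pow_iff (hc : v c ≠ 0) {m : ℕ} {F : MvPolynomial (Fin 3) K} :
    F ∈ pointIdeal v ^ m ↔
      ∀ a ∈ (shearEquiv (fun j => v j / v c) c F).support, m ≤ a (c + 1) + a (c + 2) := by
  rw [← mem_span_X_pow_iff, ← map_shearEquiv_pointIdeal hc, ← Ideal.map_pow]
  change _ ↔ (shearEquiv (fun j => v j / v c) c).toRingEquiv F ∈
    Ideal.map (shearEquiv (fun j => v j / v c) c).toRingEquiv _
  rw [← Ideal.comap_symm, Ideal.mem_comap, RingEquiv.symm_apply_apply]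

/-- A derivation of the form `∑ ℓ_j ∂_j` with `ℓ_j` in the ideal `pointIdeal v` which acts on
`pointIdeal v ^ n` as multiplication by `n` modulo `pointIdeal v ^ (n + 1)`. -/
lemma exists_sum_pderiv_sub_mem (hv : v ≠ 0) :
    ∃ l : Fin 3 → MvPolynomial (Fin 3) K, (∀ j, l j ∈ pointIdeal v) ∧
      ∀ n : ℕ, ∀ F ∈ pointIdeal v ^ n,
        ∑ j, l j * pderiv j F - (n : MvPolynomial (Fin 3) K) * F ∈ pointIdeal v ^ (n + 1) := by
  obtain ⟨c, hc⟩ : ∃ c, v c ≠ 0 := Function.ne_iff.1 hv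
  have hP := pointIdeal_eq_span hc
  set l : Fin 3 → MvPolynomial (Fin 3) K := fun j => X j - C (v j / v c) * X c with hl
  have hlmem (j) : l j ∈ pointIdeal v := hP ▸ Ideal.subset_span ⟨j, rfl⟩
  have hlc : l c = 0 := by simp [hl, hc]
  let E : Derivation K (MvPolynomial (Fin 3) K) (MvPolynomial (Fin 3) K) :=
    ∑ j, l j • pderiv j
  have hE (F) : E F = ∑ j, l j * pderiv j F := by
    simp [E, Fin.sum_univ_three]
  have hEmem (F) : E F ∈ pointIdeal v := by
    rw [hE]
    exact Ideal.sum_mem _ fun j _ => Ideal.mul_mem_right _ _ (hlmem j)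
  have hEl (k) : E (l k) = l k := by
    have hX (j) : E (X j) = l j := by
      rw [hE, Finset.sum_eq_single j] <;> simp +contextual [pderiv_X, eq_comm]
    conv_lhs => rw [hl]
    simp only [map_sub, Derivation.leibniz, hX, hlc]
    simp [← algebraMap_eq]
  have h1 (F) (hF : F ∈ pointIdeal v) : E F - F ∈ pointIdeal v ^ 2 := by
    rw [hP] at hF
    induction hF using Submodule.span_induction with
    | mem x hx => obtain ⟨k, rfl⟩ := hx; rw [hEl, sub_self]; exact zero_mem _
    | zero => simp
    | add x y _ _ hx hy => rw [map_add, add_sub_add_comm]; exact add_mem hx hy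
    | smul a x hx ih =>
      have hx : x ∈ pointIdeal v := hP ▸ hx
      have : E (a • x) - a • x = a * (E x - x) + x * E a := by
        simp [Derivation.leibniz]; ring
      rw [this]
      refine add_mem (Ideal.mul_mem_left _ _ ih) ?_
      rw [sq]
      exact Ideal.mul_mem_mul hx (hEmem a)
  refine ⟨l, hlmem, fun n => ?_⟩
  simp only [← hE]
  induction n with
  | zero => intro F _; simpa using hEmem F
  | succ n ih =>
    intro F hF
    rw [pow_succ] at hF
    induction hF using Submodule.mul_induction_on' with
    | mem_mul_mem f hf g hg =>
      have : E (f * g) - ((n + 1 : ℕ) : MvPolynomial (Fin 3) K) * (f * g) =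
          f * (E g - g) + (E f - n * f) * g := by
        simp [Derivation.leibniz]; ring
      rw [this]
      refine add_mem ?_ ?_
      · rw [add_assoc, pow_add]
        exact Ideal.mul_mem_mul hf (h1 g hg)
      · rw [pow_succ]
        exact Ideal.mul_mem_mul (ih f hf) hg
    | add f _ g _ hf hg =>
      rw [map_add, mul_add, add_sub_add_comm]
      exact add_mem hf hg

lemma pderiv_mem_pow_of_mem_pow_succ {σ R : Type*} [CommRing R] (P : Ideal (MvPolynomial σ R))
    {n : ℕ} {F : MvPolynomial σ R} (hF : F ∈ P ^ (n + 1)) (j : σ) : pderiv j F ∈ P ^ n := by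
  induction n generalizing F with
  | zero => simp
  | succ n ih =>
    rw [pow_succ] at hF
    induction hF using Submodule.mul_induction_on' with
    | mem_mul_mem f hf g hg =>
      rw [Derivation.leibniz]
      refine add_mem (Ideal.mul_mem_right _ _ hf) ?_
      rw [smul_eq_mul, mul_comm, pow_succ]
      exact Ideal.mul_mem_mul (ih hf) hg
    | add f _ g _ hf hg => rw [map_add]; exact add_mem hf hg

lemma mem_pointIdeal_pow_succ_iff [CharZero K] (hv : v ≠ 0) {m : ℕ} (hm : 1 ≤ m)
    {F : MvPolynomial (Fin 3) K} :
    F ∈ pointIdeal v ^ (m + 1) ↔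
      F ∈ pointIdeal v ^ m ∧ ∀ j, pderiv j F ∈ pointIdeal v ^ m := by
  refine ⟨fun h => ⟨Ideal.pow_le_pow_right m.le_succ h,
    fun j => pderiv_mem_pow_of_mem_pow_succ _ h j⟩, fun ⟨h0, h1⟩ => ?_⟩
  obtain ⟨l, hl, hE⟩ := exists_sum_pderiv_sub_mem hv
  have h2 : ∑ j, l j * pderiv j F ∈ pointIdeal v ^ (m + 1) := by
    refine Ideal.sum_mem _ fun j _ => ?_
    rw [pow_succ']
    exact Ideal.mul_mem_mul (hl j) (h1 j)
  have h3 : (m : MvPolynomial (Fin 3) K) * F ∈ pointIdeal v ^ (m + 1) := by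
    simpa using sub_mem h2 (hE m F h0)
  have h4 := Ideal.mul_mem_left _ (C (m : K)⁻¹) h3
  have hm0 : (m : K) ≠ 0 := by exact_mod_cast (by omega : m ≠ 0)
  rwa [← mul_assoc, ← map_natCast (C (σ := Fin 3) (R := K)), ← C_mul, inv_mul_cancel₀ hm0, C_1,
    one_mul] at h4

end PointIdeal

section HilbertFunction

attribute [local instance] MvPolynomial.gradedAlgebra

variable {K : Type*} [Field K] {v : Fin 3 → K}

/-- The degree-`d` component of an ideal of `K[X₀, X₁, X₂]`. -/
noncomputable def gradedPart (I : Ideal (MvPolynomial (Fin 3) K)) (d : ℕ) :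
    Submodule K (MvPolynomial (Fin 3) K) :=
  homogeneousSubmodule (Fin 3) K d ⊓ I.restrictScalars K

lemma mem_gradedPart {I : Ideal (MvPolynomial (Fin 3) K)} {d : ℕ} {F : MvPolynomial (Fin 3) K} :
    F ∈ gradedPart I d ↔ F.IsHomogeneous d ∧ F ∈ I :=
  Iff.rfl

lemma gradedPart_le (I : Ideal (MvPolynomial (Fin 3) K)) (d : ℕ) :
    gradedPart I d ≤ homogeneousSubmodule (Fin 3) K d :=
  inf_le_left

instance finite_homogeneousSubmodule (d : ℕ) :
    Module.Finite K (homogeneousSubmodule (Fin 3) K d) :=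
  Module.Finite.iff_fg.2 (homogeneousSubmodule_fg (Fin 3) K d)

instance finite_gradedPart (I : Ideal (MvPolynomial (Fin 3) K)) (d : ℕ) :
    Module.Finite K (gradedPart I d) :=
  Submodule.finiteDimensional_inf_left _ _

lemma card_sigma_antidiagonal (m : ℕ) :
    ((Finset.range m).sigma fun k => Finset.HasAntidiagonal.antidiagonal k).card =
      (m + 1).choose 2 := by
  rw [Finset.card_sigma]
  simp only [Finset.Nat.card_antidiagonal]
  induction m with
  | zero => simp
  | succ m ih =>
    rw [Finset.sum_range_succ, ih, Nat.choose_succ_succ' (m + 1) 1, Nat.choose_one_right, add_comm]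

lemma finrank_gradedPart_pointIdeal_pow (hv : v ≠ 0) {m d : ℕ} (hd : m ≤ d) :
    Module.finrank K (gradedPart (pointIdeal v ^ m) d) + (m + 1).choose 2 =
      Module.finrank K (homogeneousSubmodule (Fin 3) K d) := by
  obtain ⟨c, hc⟩ : ∃ c, v c ≠ 0 := Function.ne_iff.1 hv
  set φ := shearEquiv (fun j => v j / v c) c with hφ
  let ι := (Finset.range m).sigma fun k => Finset.HasAntidiagonal.antidiagonal k
  let e : ι → (Fin 3 →₀ ℕ) := fun p => Finsupp.single (c + 1) p.1.2.1 +
    Finsupp.single (c + 2) p.1.2.2 + Finsupp.single c (d - p.1.1)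
  have hsum (a : Fin 3 →₀ ℕ) : a.degree = a c + a (c + 1) + a (c + 2) := by
    rw [Finsupp.degree_eq_sum, ← Equiv.sum_comp (Equiv.addLeft c) a, Fin.sum_univ_three]
    simp
  have hec (p : ι) : e p c = d - p.1.1 := by simp [e]
  have he1 (p : ι) : e p (c + 1) = p.1.2.1 := by simp [e]
  have he2 (p : ι) : e p (c + 2) = p.1.2.2 := by simp [e]
  have hι (p : ι) : p.1.1 < m ∧ p.1.2.1 + p.1.2.2 = p.1.1 := by
    obtain ⟨h1, h2⟩ := Finset.mem_sigma.1 p.2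
    exact ⟨Finset.mem_range.1 h1, Finset.HasAntidiagonal.mem_antidiagonal.1 h2⟩
  have he_inj : Function.Injective e := by
    intro p q hpq
    have h1 : p.1.2.1 = q.1.2.1 := by rw [← he1, hpq, he1]
    have h2 : p.1.2.2 = q.1.2.2 := by rw [← he2, hpq, he2]
    have h3 : p.1.1 = q.1.1 := by rw [← (hι p).2, ← (hι q).2, h1, h2]
    exact Subtype.ext (Sigma.ext h3 (heq_of_eq (Prod.ext h1 h2)))
  have hedeg (p : ι) : (e p).degree = d := by
    rw [hsum, hec, he1, he2]
    have := hι p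
    omega
  let T : homogeneousSubmodule (Fin 3) K d →ₗ[K] (ι → K) :=
    LinearMap.pi fun p => (lcoeff K (e p)) ∘ₗ φ.toLinearMap ∘ₗ
      (homogeneousSubmodule (Fin 3) K d).subtype
  have hT (F) (p) : T F p = coeff (e p) (φ F) := rfl
  have hker : LinearMap.ker T = (gradedPart (pointIdeal v ^ m) d).submoduleOf
      (homogeneousSubmodule (Fin 3) K d) := by
    ext ⟨F, hF⟩
    have hF' : F.IsHomogeneous d := hF
    have hφF : (φ F).IsHomogeneous d := isHomogeneous_shear _ c hF'
    rw [LinearMap.mem_ker, Submodule.submoduleOf, Submodule.mem_comap, Submodule.coe_subtype,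
      mem_gradedPart, mem_pointIdeal_pow_iff hc, ← hφ]
    refine ⟨fun h => ⟨hF, fun a ha => ?_⟩, fun h => funext fun p => ?_⟩
    · by_contra! hlt
      have hdeg : a.degree = d := by
        by_contra hne
        exact mem_support_iff.1 ha (hφF.coeff_eq_zero hne)
      let p : ι := ⟨⟨a (c + 1) + a (c + 2), (a (c + 1), a (c + 2))⟩, by simp [ι, hlt]⟩
      have hp : e p = a := by
        ext j
        rw [hsum] at hdeg
        rcases (by decide : ∀ c j : Fin 3, j = c ∨ j = c + 1 ∨ j = c + 2) c j with rfl | rfl | rfl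
        · rw [hec]; simp only [p]; omega
        · rw [he1]
        · rw [he2]
      have := congrFun h p
      rw [hT, hp] at this
      exact mem_support_iff.1 ha this
    · rw [hT]
      by_contra hne
      have := h.2 _ (mem_support_iff.2 hne)
      rw [he1, he2, (hι p).2] at this
      exact absurd (hι p).1 (by omega)
  have hsurj : Function.Surjective T := by
    intro g
    have hG : (∑ p, monomial (e p) (g p)).IsHomogeneous d :=
      IsHomogeneous.sum _ _ _ fun p _ => isHomogeneous_monomial _ (hedeg p)
    refine ⟨⟨φ.symm (∑ p, monomial (e p) (g p)), isHomogeneous_shear _ c hG⟩, ?_⟩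
    ext p
    rw [hT, AlgEquiv.apply_symm_apply, coeff_sum, Finset.sum_eq_single p]
    · simp
    · intro q _ hqp
      rw [coeff_monomial, if_neg (he_inj.ne hqp)]
    · simp
  have h := LinearMap.finrank_range_add_finrank_ker T
  rw [LinearMap.range_eq_top.2 hsurj, finrank_top, Module.finrank_fintype_fun_eq_card, hker,
    Fintype.card_coe, card_sigma_antidiagonal,
    (Submodule.submoduleOfEquivOfLe (gradedPart_le (pointIdeal v ^ m) d)).finrank_eq] at h
  omega

lemma isHomogeneous_pointIdeal_pow (v : Fin 3 → K) (m : ℕ) :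
    (pointIdeal v ^ m).IsHomogeneous (homogeneousSubmodule (Fin 3) K) := by
  induction m with
  | zero => rw [pow_zero, Ideal.one_eq_top]; exact Ideal.IsHomogeneous.top _
  | succ m ih =>
    rw [pow_succ]
    exact ih.mul (Ideal.homogeneous_span _ _ fun F hF => hF.1)

lemma isHomogeneous_inf_pointIdeal_pow {s : ℕ} (v : Fin s → Fin 3 → K) (m : Fin s → ℕ)
    (T : Finset (Fin s)) :
    (T.inf fun j => pointIdeal (v j) ^ m j).IsHomogeneous (homogeneousSubmodule (Fin 3) K) := by
  rw [Finset.inf_eq_iInf]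
  exact Ideal.IsHomogeneous.iInf₂ fun j _ => isHomogeneous_pointIdeal_pow _ _

lemma finrank_gradedPart_inf {I J : Ideal (MvPolynomial (Fin 3) K)}
    (hI : I.IsHomogeneous (homogeneousSubmodule (Fin 3) K))
    (hJ : J.IsHomogeneous (homogeneousSubmodule (Fin 3) K)) {d : ℕ}
    (h : idealOfVars (Fin 3) K ^ d ≤ I ⊔ J) :
    Module.finrank K (homogeneousSubmodule (Fin 3) K d) +
        Module.finrank K (gradedPart (I ⊓ J) d) =
      Module.finrank K (gradedPart I d) + Module.finrank K (gradedPart J d) := by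
  have hsup : gradedPart I d ⊔ gradedPart J d = homogeneousSubmodule (Fin 3) K d := by
    refine le_antisymm (sup_le (gradedPart_le _ _) (gradedPart_le _ _)) fun F hF => ?_
    have hF' : F.IsHomogeneous d := hF
    have hmem : F ∈ I ⊔ J := by
      refine h ((mem_pow_idealOfVars_iff' _ _).2 fun x hx => ?_)
      exact hF'.coeff_eq_zero hx.ne
    obtain ⟨f, hf, g, hg, rfl⟩ := Submodule.mem_sup.1 hmem
    have heq := homogeneousComponent_eq_self hF'
    rw [map_add] at heq
    rw [← heq]
    exact Submodule.add_mem_sup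
      ⟨homogeneousComponent_mem _ _, homogeneousComponent_mem_of_mem hI hf d⟩
      ⟨homogeneousComponent_mem _ _, homogeneousComponent_mem_of_mem hJ hg d⟩
  have hinf : gradedPart I d ⊓ gradedPart J d = gradedPart (I ⊓ J) d := by
    ext F
    simp only [Submodule.mem_inf, mem_gradedPart]
    tauto
  rw [← hsup, ← hinf]
  exact Submodule.finrank_sup_add_finrank_inf_eq _ _

lemma X_mul_sub_mem_pointIdeal (v : Fin 3 → K) (a b : Fin 3) :
    C (v a) * X b - C (v b) * X a ∈ pointIdeal v := by
  refine Ideal.subset_span ⟨⟨1, ?_⟩, ?_⟩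
  · exact (isHomogeneous_C_mul_X _ _).sub (isHomogeneous_C_mul_X _ _)
  · simp [mul_comm]

lemma idealOfVars_le_sup_pointIdeal {v w : Fin 3 → K} (hw : w ≠ 0) (h : ∀ c : K, v ≠ c • w) :
    idealOfVars (Fin 3) K ≤ pointIdeal v ⊔ pointIdeal w := by
  set I := pointIdeal v ⊔ pointIdeal w
  have hvI (a b) : C (v a) * X b - C (v b) * X a ∈ I :=
    Ideal.mem_sup_left (X_mul_sub_mem_pointIdeal v a b)
  have hwI (a b) : C (w a) * X b - C (w b) * X a ∈ I :=
    Ideal.mem_sup_right (X_mul_sub_mem_pointIdeal w a b)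
  have hC (k : K) (hk : k ≠ 0) (F : MvPolynomial (Fin 3) K) (hF : C k * F ∈ I) : F ∈ I := by
    have := I.mul_mem_left (C k⁻¹) hF
    rwa [← mul_assoc, ← C_mul, inv_mul_cancel₀ hk, C_1, one_mul] at this
  obtain ⟨b, hb⟩ : ∃ b, w b ≠ 0 := Function.ne_iff.1 hw
  obtain ⟨a, ha⟩ : ∃ a, v a ≠ (v b / w b) * w a := by
    by_contra! hall
    exact h (v b / w b) (funext hall)
  have hdet : v a * w b - v b * w a ≠ 0 := by
    intro h0
    apply ha
    field_simp
    linear_combination h0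
  have hXb : X b ∈ I := by
    refine hC _ hdet _ ?_
    have := I.sub_mem (I.mul_mem_left (C (w b)) (hvI a b)) (I.mul_mem_left (C (v b)) (hwI a b))
    convert this using 1
    simp only [map_sub, map_mul]
    ring
  rw [idealOfVars, Ideal.span_le]
  rintro _ ⟨j, rfl⟩
  refine hC _ hb _ ?_
  have := I.add_mem (hwI b j) (I.mul_mem_left (C (w j)) hXb)
  rwa [sub_add_cancel] at this

lemma exists_idealOfVars_pow_le_sup {s : ℕ} {v : Fin s → Fin 3 → K} (hv0 : ∀ j, v j ≠ 0)
    (hdist : ∀ i j, i ≠ j → ∀ c : K, v i ≠ c • v j) (m : Fin s → ℕ) {T : Finset (Fin s)}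
    {j : Fin s} (hj : j ∉ T) :
    ∃ N, idealOfVars (Fin 3) K ^ N ≤
      pointIdeal (v j) ^ m j ⊔ T.inf fun k => pointIdeal (v k) ^ m k := by
  refine Ideal.exists_pow_le_of_le_radical_of_fg ?_ (idealOfVars_fg _ _)
  rw [Ideal.radical_eq_sInf]
  refine le_sInf fun p ⟨hle, hp⟩ => ?_
  have h1 := hp.le_of_pow_le (le_sup_left.trans hle)
  obtain ⟨k, hk, h2⟩ := hp.inf_le'.1 (le_sup_right.trans hle)
  have hjk : j ≠ k := fun h => hj (h ▸ hk)
  exact (idealOfVars_le_sup_pointIdeal (hv0 k) (hdist j k hjk)).trans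
    (sup_le h1 (hp.le_of_pow_le h2))

lemma exists_finrank_gradedPart_inf_pointIdeal_pow {s : ℕ} {v : Fin s → Fin 3 → K}
    (hv0 : ∀ j, v j ≠ 0) (hdist : ∀ i j, i ≠ j → ∀ c : K, v i ≠ c • v j) (m : Fin s → ℕ)
    (T : Finset (Fin s)) :
    ∃ N, ∀ d ≥ N, Module.finrank K (gradedPart (T.inf fun j => pointIdeal (v j) ^ m j) d) +
      ∑ j ∈ T, (m j + 1).choose 2 = Module.finrank K (homogeneousSubmodule (Fin 3) K d) := by
  induction T using Finset.induction_on with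
  | empty =>
    refine ⟨0, fun d _ => ?_⟩
    have : gradedPart (⊤ : Ideal (MvPolynomial (Fin 3) K)) d = homogeneousSubmodule (Fin 3) K d :=
      inf_eq_left.2 fun _ _ => trivial
    rw [Finset.inf_empty, this, Finset.sum_empty, add_zero]
  | insert j T hj ih =>
    obtain ⟨N₁, hN₁⟩ := ih
    obtain ⟨N₂, hN₂⟩ := exists_idealOfVars_pow_le_sup hv0 hdist m hj
    refine ⟨N₁ + N₂ + m j, fun d hd => ?_⟩
    have h1 := hN₁ d (by omega)
    have h2 := finrank_gradedPart_pointIdeal_pow (hv0 j) (m := m j) (d := d) (by omega)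
    have h3 := finrank_gradedPart_inf (isHomogeneous_pointIdeal_pow (v j) (m j))
      (isHomogeneous_inf_pointIdeal_pow v m T) (d := d)
      ((Ideal.pow_le_pow_right (by omega)).trans hN₂)
    rw [Finset.inf_insert, Finset.sum_insert hj]
    omega

end HilbertFunction

section Omega

attribute [local instance] MvPolynomial.gradedAlgebra

variable {K : Type*} [Field K]

lemma homogeneousComponent_pderiv {σ R : Type*} [CommSemiring R] (n : ℕ) (j : σ)
    (F : MvPolynomial σ R) :
    homogeneousComponent n (pderiv j F) = pderiv j (homogeneousComponent (n + 1) F) := by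
  ext a
  simp [coeff_homogeneousComponent, coeff_pderiv]

lemma mem_omega1Rel_iff {I : Ideal (MvPolynomial (Fin 3) K)}
    {x : Fin 3 → MvPolynomial (Fin 3) K} :
    x ∈ omega1Rel I ↔ ∃ F ∈ I, ∀ j, x j - pderiv j F ∈ I := by
  constructor
  · intro hx
    obtain ⟨w, hw, y, hy, rfl⟩ := Submodule.mem_sup.1 hx
    have hw' (j) : w j ∈ I := hw j trivial
    obtain ⟨F, hF, hF'⟩ : ∃ F ∈ I, ∀ j, y j - pderiv j F ∈ I := by
      clear hx
      induction hy using Submodule.span_induction with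
      | mem x hx =>
        obtain ⟨F, hF, rfl⟩ := hx
        exact ⟨F, hF, by simp⟩
      | zero => exact ⟨0, zero_mem _, by simp⟩
      | add x y _ _ hx hy =>
        obtain ⟨F, hF, hF'⟩ := hx
        obtain ⟨G, hG, hG'⟩ := hy
        refine ⟨F + G, add_mem hF hG, fun j => ?_⟩
        rw [map_add, Pi.add_apply, add_sub_add_comm]
        exact add_mem (hF' j) (hG' j)
      | smul a x _ hx =>
        obtain ⟨F, hF, hF'⟩ := hx
        refine ⟨a * F, I.mul_mem_left a hF, fun j => ?_⟩
        have : (a • x) j - pderiv j (a * F) = a * (x j - pderiv j F) - pderiv j a * F := by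
          simp [Derivation.leibniz]; ring
        rw [this]
        exact sub_mem (I.mul_mem_left _ (hF' j)) (I.mul_mem_left _ hF)
    refine ⟨F, hF, fun j => ?_⟩
    rw [Pi.add_apply, add_sub_assoc]
    exact add_mem (hw' j) (hF' j)
  · rintro ⟨F, hF, hx⟩
    have : x = (fun j => x j - pderiv j F) + fun j => pderiv j F := by ext1 j; simp
    rw [this]
    exact Submodule.add_mem_sup (fun j _ => hx j) (Submodule.subset_span ⟨F, hF, rfl⟩)

lemma finrank_pi_univ (W : Submodule K (MvPolynomial (Fin 3) K)) [Module.Finite K W] :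
    Module.finrank K (Submodule.pi Set.univ fun _ : Fin 3 => W) = 3 * Module.finrank K W := by
  let f : (Fin 3 → W) →ₗ[K] (Fin 3 → MvPolynomial (Fin 3) K) :=
    LinearMap.pi fun j => W.subtype ∘ₗ LinearMap.proj j
  have hf : LinearMap.range f = Submodule.pi Set.univ fun _ : Fin 3 => W := by
    ext x
    constructor
    · rintro ⟨y, rfl⟩ j _
      exact (y j).2
    · intro hx
      exact ⟨fun j => ⟨x j, hx j trivial⟩, rfl⟩
  have hinj : Function.Injective f := fun x y h => funext fun j => Subtype.ext (congrFun h j)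
  rw [← hf, LinearMap.finrank_range_of_inj hinj, Module.finrank_pi_fintype]
  simp

/-- The Hilbert function of `Ω¹` in terms of those of `I` and of the ideal
`J = {F ∈ I | ∂_j F ∈ I for all j}`. -/
lemma omega1HF_add {I J : Ideal (MvPolynomial (Fin 3) K)}
    (hI : I.IsHomogeneous (homogeneousSubmodule (Fin 3) K))
    (hJ : ∀ F, F ∈ J ↔ F ∈ I ∧ ∀ j, pderiv j F ∈ I) (n : ℕ) :
    omega1HF I (n + 1) + 3 * Module.finrank K (gradedPart I n) +
        Module.finrank K (gradedPart I (n + 1)) =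
      3 * Module.finrank K (homogeneousSubmodule (Fin 3) K n) +
        Module.finrank K (gradedPart J (n + 1)) := by
  set V : Submodule K (Fin 3 → MvPolynomial (Fin 3) K) :=
    Submodule.pi Set.univ fun _ : Fin 3 => homogeneousSubmodule (Fin 3) K n with hV
  let f : (gradedPart I (n + 1) × (Fin 3 → gradedPart I n)) →ₗ[K]
      (Fin 3 → MvPolynomial (Fin 3) K) :=
    LinearMap.pi fun j =>
      (pderiv j : Derivation K _ _).toLinearMap ∘ₗ (gradedPart I (n + 1)).subtype ∘ₗ
          LinearMap.fst K _ _ +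
        (gradedPart I n).subtype ∘ₗ LinearMap.proj j ∘ₗ LinearMap.snd K _ _
  have hf (y j) : f y j = pderiv j (y.1 : MvPolynomial (Fin 3) K) + y.2 j := rfl
  have hrange : LinearMap.range f = V ⊓ (omega1Rel I).restrictScalars K := by
    ext x
    constructor
    · rintro ⟨⟨F, w⟩, rfl⟩
      refine ⟨fun j _ => ?_, mem_omega1Rel_iff.2 ⟨F, F.2.2, fun j => ?_⟩⟩
      · exact add_mem (IsHomogeneous.pderiv F.2.1) (w j).2.1
      · rw [hf, add_sub_cancel_left]
        exact (w j).2.2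
    · rintro ⟨hxV, hx⟩
      obtain ⟨F, hF, hx⟩ := mem_omega1Rel_iff.1 hx
      refine ⟨⟨⟨homogeneousComponent (n + 1) F, homogeneousComponent_mem _ _,
        homogeneousComponent_mem_of_mem hI hF _⟩,
        fun j => ⟨homogeneousComponent n (x j - pderiv j F), homogeneousComponent_mem _ _,
        homogeneousComponent_mem_of_mem hI (hx j) _⟩⟩, ?_⟩
      ext1 j
      have hxj : (x j).IsHomogeneous n := hxV j trivial
      change pderiv j (homogeneousComponent (n + 1) F) +
        homogeneousComponent n (x j - pderiv j F) = x j
      rw [map_sub, homogeneousComponent_pderiv, add_sub_cancel, homogeneousComponent_eq_self hxj]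
  have hker : Module.finrank K (LinearMap.ker f) = Module.finrank K (gradedPart J (n + 1)) := by
    refine LinearEquiv.finrank_eq (LinearEquiv.ofBijective
      (((gradedPart I (n + 1)).subtype ∘ₗ LinearMap.fst K _ _ ∘ₗ
        (LinearMap.ker f).subtype).codRestrict _ ?_) ⟨?_, ?_⟩)
    · rintro ⟨⟨F, w⟩, h⟩
      refine ⟨F.2.1, (hJ _).2 ⟨F.2.2, fun j => ?_⟩⟩
      have := congrFun (LinearMap.mem_ker.1 h) j
      rw [hf] at this
      change pderiv j (F : MvPolynomial (Fin 3) K) ∈ I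
      rw [show pderiv j (F : MvPolynomial (Fin 3) K) = _ from eq_neg_of_add_eq_zero_left this]
      exact neg_mem (w j).2.2
    · rintro ⟨⟨F, w⟩, h⟩ ⟨⟨F', w'⟩, h'⟩ heq
      have hFF : F = F' := Subtype.ext (Subtype.ext_iff.1 heq :)
      subst hFF
      have : w = w' := by
        ext1 j
        have h1 := congrFun (LinearMap.mem_ker.1 h) j
        have h2 := congrFun (LinearMap.mem_ker.1 h') j
        rw [hf] at h1 h2
        exact Subtype.ext (add_left_cancel (h1.trans h2.symm))
      subst this
      rfl
    · rintro ⟨F, hF, hFJ⟩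
      have hF' : F.IsHomogeneous (n + 1) := hF
      obtain ⟨hFI, hdF⟩ := (hJ F).1 hFJ
      refine ⟨⟨⟨⟨F, hF, hFI⟩, fun j => ⟨-pderiv j F, neg_mem (IsHomogeneous.pderiv hF'),
        neg_mem (hdF j)⟩⟩, ?_⟩, rfl⟩
      rw [LinearMap.mem_ker]
      ext1 j
      rw [hf]
      exact add_neg_cancel _
  have hfin : Module.Finite K V :=
    Module.Finite.iff_fg.2 (Submodule.fg_pi fun _ => homogeneousSubmodule_fg (Fin 3) K n)
  have h1 := LinearMap.finrank_range_add_finrank_ker f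
  rw [hker, hrange, Module.finrank_prod, Module.finrank_pi_fintype, Fin.sum_univ_three] at h1
  have h2 := Submodule.finrank_quotient_add_finrank
    (Submodule.comap V.subtype ((omega1Rel I).restrictScalars K))
  have h3 : Module.finrank K (Submodule.comap V.subtype ((omega1Rel I).restrictScalars K)) =
      Module.finrank K ↥(V ⊓ (omega1Rel I).restrictScalars K) := by
    rw [← Submodule.map_comap_subtype, Submodule.finrank_map_subtype_eq]
  rw [h3, finrank_pi_univ] at h2
  have h4 : omega1HF I (n + 1) = Module.finrank K
    (V ⧸ Submodule.comap V.subtype ((omega1Rel I).restrictScalars K)) := rfl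
  omega

end Omega

/-- Let `W = m_1 P_1 + ⋯ + m_s P_s` be a fat point scheme in `ℙ²` over a
field of characteristic zero. Then the Hilbert polynomial of `Ω¹_{R_W/K}` is the constant
`Σ_j (1/2)(3 m_j - 2)(m_j + 1)`. -/
theorem hilbertPolynomial_kaehler_one_forms_P2 {K : Type*} [Field K] [CharZero K]
    (s : ℕ) (hs : 0 < s)
    (v : Fin s → (Fin 3 → K))
    (hv0 : ∀ j, v j ≠ 0)
    (hdist : ∀ i j, i ≠ j → ∀ c : K, v i ≠ c • v j)
    (m : Fin s → ℕ) (hm : ∀ j, 1 ≤ m j) :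
    ∃ i₀ : ℕ, ∀ i ≥ i₀,
      (omega1HF (⨅ j, (pointIdeal (v j)) ^ (m j)) i : ℚ) =
        ∑ j : Fin s, (3 * (m j : ℚ) - 2) * ((m j : ℚ) + 1) / 2 := by
  have hinf (m : Fin s → ℕ) : (⨅ j, pointIdeal (v j) ^ m j) =
      Finset.univ.inf fun j => pointIdeal (v j) ^ m j := by
    rw [Finset.inf_eq_iInf]; simp
  obtain ⟨N₁, hN₁⟩ := exists_finrank_gradedPart_inf_pointIdeal_pow hv0 hdist m Finset.univ
  obtain ⟨N₂, hN₂⟩ :=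
    exists_finrank_gradedPart_inf_pointIdeal_pow hv0 hdist (fun j => m j + 1) Finset.univ
  refine ⟨N₁ + N₂ + 1, fun i hi => ?_⟩
  obtain ⟨n, rfl⟩ : ∃ n, i = n + 1 := ⟨i - 1, by omega⟩
  have h1 := hN₁ n (by omega)
  have h2 := hN₁ (n + 1) (by omega)
  have h3 := hN₂ (n + 1) (by omega)
  have h4 := omega1HF_add (J := Finset.univ.inf fun j => pointIdeal (v j) ^ (m j + 1))
    (isHomogeneous_inf_pointIdeal_pow v m Finset.univ) (fun F => by
      simp only [Submodule.mem_finsetInf, Finset.mem_univ, true_imp_iff,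
        fun j => mem_pointIdeal_pow_succ_iff (hv0 j) (hm j) (F := F)]
      grind) n
  have hsum : ∑ j : Fin s, (3 * (m j : ℚ) - 2) * ((m j : ℚ) + 1) / 2 =
      4 * ((∑ j, (m j + 1).choose 2 : ℕ) : ℚ) - ((∑ j, (m j + 1 + 1).choose 2 : ℕ) : ℚ) := by
    push_cast
    rw [Finset.mul_sum, ← Finset.sum_sub_distrib]
    refine Finset.sum_congr rfl fun j _ => ?_
    rw [Nat.cast_choose_two, Nat.cast_choose_two]
    push_cast
    ring
  rw [hsum, hinf, eq_sub_iff_add_eq]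
  norm_cast
  omega
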